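/- Suppose every subgraph G^τ, τ ∈ T, of the decomposition is acyclic. Then the optimal value of the decomposition-based dual equals the optimal value of the Lagrange dual: sup{U(θ^T) : θ^T ∈ Θ^T} = sup_φ D(φ), and both are equal to the optimal value min_{μ∈L} ⟨θ,μ⟩ of the local polytope relaxation. -/

import Mathlib

open Finset

/-- Minimum of a real-valued function on a nonempty finite type. -/
noncomputable def fmin {α : Type*} [Fintype α] [Nonempty α] (f : α → ℝ) : ℝ :=
  Finset.univ.inf' Finset.univ_nonempty f

variable {V : Type} [Fintype V] [DecidableEq V]

/-- Reparametrized unary cost `θ^φ_u(s) = θ_u(s) − Σ_{v : uv∈E} φ_{u,v}(s)`. -/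
noncomputable def repUnary (G : SimpleGraph V) [DecidableRel G.Adj]
    (Y : V → Type) (θv : ∀ u, Y u → ℝ) (φ : ∀ (u v : V), Y u → ℝ) (u : V) (s : Y u) : ℝ :=
  θv u s - ∑ v, if G.Adj u v then φ u v s else 0

/-- Reparametrized pairwise cost `θ^φ_{uv}(s,t) = θ_{uv}(s,t) + φ_{u,v}(s) + φ_{v,u}(t)`. -/
def repPair (Y : V → Type) (θe : ∀ u v, Y u → Y v → ℝ) (φ : ∀ (u v : V), Y u → ℝ)
    (u v : V) (s : Y u) (t : Y v) : ℝ :=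
  θe u v s t + φ u v s + φ v u t

/-- The Lagrange dual function
`D(φ) = Σ_u min_s θ^φ_u(s) + Σ_{uv∈E} min_{(s,t)} θ^φ_{uv}(s,t)`
(each unordered edge is counted once via the halved sum over ordered pairs). -/
noncomputable def dualD (G : SimpleGraph V) [DecidableRel G.Adj]
    (Y : V → Type) [∀ u, Fintype (Y u)] [∀ u, Nonempty (Y u)]
    (θv : ∀ u, Y u → ℝ) (θe : ∀ u v, Y u → Y v → ℝ)
    (φ : ∀ (u v : V), Y u → ℝ) : ℝ :=
  (∑ u, fmin (fun s : Y u => repUnary G Y θv φ u s)) +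
    (∑ u, ∑ v, if G.Adj u v then
        fmin (fun p : Y u × Y v => repPair Y θe φ u v p.1 p.2) else 0) / 2

/-- Membership in the local polytope `L`: `μ ≥ 0`, each unary block lies in the
probability simplex, both coupling (marginalization) constraints hold, the
pairwise blocks are symmetric (one variable per unordered edge) and vanish on
non-edges. -/
def memLocal (G : SimpleGraph V) [DecidableRel G.Adj]
    (Y : V → Type) [∀ u, Fintype (Y u)]
    (μv : ∀ u, Y u → ℝ) (μe : ∀ u v, Y u → Y v → ℝ) : Prop :=
  (∀ u s, 0 ≤ μv u s) ∧
  (∀ u v, G.Adj u v → ∀ s t, 0 ≤ μe u v s t) ∧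
  (∀ u v s t, μe u v s t = μe v u t s) ∧
  (∀ u v, ¬ G.Adj u v → ∀ s t, μe u v s t = 0) ∧
  (∀ u, ∑ s, μv u s = 1) ∧
  (∀ u v, G.Adj u v → ∀ t : Y v, ∑ s, μe u v s t = μv v t) ∧
  (∀ u v, G.Adj u v → ∀ s : Y u, ∑ t, μe u v s t = μv u s)

/-- The objective `⟨θ, μ⟩` of the local polytope relaxation
(each unordered edge counted once via the halved sum over ordered pairs). -/
noncomputable def ip (G : SimpleGraph V) [DecidableRel G.Adj]
    (Y : V → Type) [∀ u, Fintype (Y u)]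
    (θv : ∀ u, Y u → ℝ) (θe : ∀ u v, Y u → Y v → ℝ)
    (μv : ∀ u, Y u → ℝ) (μe : ∀ u v, Y u → Y v → ℝ) : ℝ :=
  (∑ u, ∑ s, θv u s * μv u s) +
    (∑ u, ∑ v, if G.Adj u v then ∑ s, ∑ t, θe u v s t * μe u v s t else 0) / 2

/-- The decomposition-based dual value `U(θ^T)`: the sum over the slave
subproblems of their minimal energies (each unordered slave edge counted once
via the halved ordered sum). -/
noncomputable def Udec (G : SimpleGraph V)
    (Y : V → Type) [∀ u, Fintype (Y u)] [∀ u, Nonempty (Y u)]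
    (T : Type) [Fintype T] (H : T → G.Subgraph)
    [∀ τ, DecidablePred (· ∈ (H τ).verts)] [∀ τ, DecidableRel (H τ).Adj]
    (θτv : ∀ τ : T, ∀ u, Y u → ℝ) (θτe : ∀ τ : T, ∀ u v, Y u → Y v → ℝ) : ℝ :=
  ∑ τ, fmin (fun y : ∀ u, Y u =>
    (∑ u, if u ∈ (H τ).verts then θτv τ u (y u) else 0) +
      (∑ u, ∑ v, if (H τ).Adj u v then θτe τ u v (y u) (y v) else 0) / 2)

lemma fmin_le {α : Type*} [Fintype α] [Nonempty α] (f : α → ℝ) (a : α) : fmin f ≤ f a :=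
  Finset.inf'_le f (Finset.mem_univ a)

lemma exists_eq_fmin {α : Type*} [Fintype α] [Nonempty α] (f : α → ℝ) : ∃ a, f a = fmin f := by
  obtain ⟨a, -, ha⟩ := Finset.exists_mem_eq_inf' Finset.univ_nonempty f
  exact ⟨a, ha.symm⟩

/-- The minimum of `f` is at most the mean of `f` under any probability vector. -/
lemma fmin_le_sum_mul {α : Type*} [Fintype α] [Nonempty α] (f w : α → ℝ)
    (hw : ∀ a, 0 ≤ w a) (hw1 : ∑ a, w a = 1) : fmin f ≤ ∑ a, f a * w a := by
  calc fmin f = ∑ a, fmin f * w a := by rw [← Finset.mul_sum, hw1, mul_one]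
    _ ≤ ∑ a, f a * w a :=
      Finset.sum_le_sum fun a _ => mul_le_mul_of_nonneg_right (fmin_le f a) (hw a)

omit [DecidableEq V] in
/-- A finite acyclic graph with at least one edge has a leaf. -/
lemma SimpleGraph.IsAcyclic.exists_leaf {F : SimpleGraph V} (h : F.IsAcyclic) {a b : V}
    (hab : F.Adj a b) : ∃ v u, F.Adj v u ∧ ∀ w, F.Adj v w → w = u := by
  have : Nonempty V := ⟨a⟩
  obtain ⟨u, v, p, hp, hmax⟩ := SimpleGraph.Walk.exists_isPath_forall_isPath_length_le_length F
  have hnil : ¬ p.Nil := by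
    have := hmax a b hab.toWalk (by simpa using hab.ne)
    rw [SimpleGraph.Walk.not_nil_iff_lt_length]
    exact Nat.lt_of_lt_of_le (by simp) this
  refine ⟨u, _, p.adj_snd hnil, fun w hadj ↦ ?_⟩
  apply h.eq_snd_of_adj_start hp hadj
  have : ¬(p.cons hadj.symm).IsPath := by grind [SimpleGraph.Walk.length_cons]
  grind [hp.cons]

/-- Splitting one edge off a halved sum over ordered adjacent pairs. -/
lemma sum_adj_deleteEdges (F : SimpleGraph V) [DecidableRel F.Adj] {v u : V} (hvu : F.Adj v u)
    [DecidableRel (F.deleteEdges {s(v, u)}).Adj] (f : V → V → ℝ) (hf : ∀ a b, f a b = f b a) :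
    (∑ a, ∑ b, if F.Adj a b then f a b else 0) / 2 =
      (∑ a, ∑ b, if (F.deleteEdges {s(v, u)}).Adj a b then f a b else 0) / 2 + f u v := by
  have hne := hvu.ne
  have key : ∀ a b, (if F.Adj a b then f a b else 0) =
      (if (F.deleteEdges {s(v, u)}).Adj a b then f a b else 0) +
        ((if a = v then if b = u then f v u else 0 else 0) +
          (if a = u then if b = v then f u v else 0 else 0)) := by
    intro a b
    have hadj : (F.deleteEdges {s(v, u)}).Adj a b ↔
        F.Adj a b ∧ ¬ ((a = v ∧ b = u) ∨ (a = u ∧ b = v)) := by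
      simp [SimpleGraph.deleteEdges_adj]
    simp only [hadj]
    have := hvu.symm
    by_cases h1 : a = v ∧ b = u
    · obtain ⟨rfl, rfl⟩ := h1
      simp [hvu, hne]
    · by_cases h2 : a = u ∧ b = v
      · obtain ⟨rfl, rfl⟩ := h2
        simp [hvu.symm, hne.symm]
      · grind
  simp only [key, Finset.sum_add_distrib]
  have h1 : (∑ a, ∑ b, if a = v then if b = u then f v u else 0 else 0) = f v u := by
    rw [Finset.sum_eq_single v (by intro a _ ha; simp [ha]) (by simp)]
    simp
  have h2 : (∑ a, ∑ b, if a = u then if b = v then f u v else 0 else 0) = f u v := by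
    rw [Finset.sum_eq_single u (by intro a _ ha; simp [ha]) (by simp)]
    simp
  rw [h1, h2, hf v u]
  ring

/-- On an acyclic graph, some labeling has energy at most `⟨θ, μ⟩` for any `μ` in the local
polytope. -/
lemma exists_energy_le_ip (Y : V → Type) [∀ u, Fintype (Y u)] [∀ u, Nonempty (Y u)]
    (θe : ∀ u v, Y u → Y v → ℝ) (hθ : ∀ u v s t, θe u v s t = θe v u t s)
    (μv : ∀ u, Y u → ℝ) (μe : ∀ u v, Y u → Y v → ℝ) (hμv : ∀ u s, 0 ≤ μv u s)
    (hμ1 : ∀ u, ∑ s, μv u s = 1) (hμs : ∀ u v s t, μe u v s t = μe v u t s)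
    (F : SimpleGraph V) : ∀ [DecidableRel F.Adj], F.IsAcyclic →
    (∀ u v, F.Adj u v → ∀ s t, 0 ≤ μe u v s t) →
    (∀ u v, F.Adj u v → ∀ s : Y u, ∑ t, μe u v s t = μv u s) →
    ∀ θv : ∀ u, Y u → ℝ, ∃ y : ∀ u, Y u,
      (∑ u, θv u (y u)) + (∑ u, ∑ v, if F.Adj u v then θe u v (y u) (y v) else 0) / 2 ≤
        ip F Y θv θe μv μe := by
  induction F using WellFoundedLT.induction with
  | ind F ih =>
  intro _ hF h0 hm θv
  by_cases hE : ∃ a b, F.Adj a b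
  · obtain ⟨a, b, hab⟩ := hE
    obtain ⟨v, u, hvu, hleaf⟩ := hF.exists_leaf hab
    classical
    have hle : F.deleteEdges {s(v, u)} ≤ F := F.deleteEdges_le _
    have hiso : ∀ a b, (F.deleteEdges {s(v, u)}).Adj a b → a ≠ v ∧ b ≠ v := by
      intro a b h
      rw [SimpleGraph.deleteEdges_adj] at h
      refine ⟨?_, ?_⟩
      · rintro rfl
        obtain rfl := hleaf _ h.1
        simp at h
      · rintro rfl
        obtain rfl := hleaf _ h.1.symm
        simp at h
    have hlt : F.deleteEdges {s(v, u)} < F := by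
      refine lt_of_le_of_ne hle fun h => ?_
      rw [← h] at hvu
      exact (hiso _ _ hvu).1 rfl
    let m : ∀ w, Y w → ℝ := fun w s => fmin fun t => θv v t + θe w v s t
    obtain ⟨y, hy⟩ := ih _ hlt (hF.anti hle) (fun a b h => h0 a b (hle h))
      (fun a b h => hm a b (hle h))
      (fun w s => θv w s + ((if w = u then m w s else 0) - (if w = v then θv w s else 0)))
    obtain ⟨t, ht⟩ := exists_eq_fmin fun t => θv v t + θe u v (y u) t
    have huv : u ≠ v := hvu.ne'
    refine ⟨Function.update y v t, ?_⟩
    unfold ip at hy ⊢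
    rw [sum_adj_deleteEdges F hvu _ (fun a b => hθ _ _ _ _),
      sum_adj_deleteEdges F hvu (fun a b => ∑ s, ∑ t, θe a b s t * μe a b s t) (fun a b => by
        rw [Finset.sum_comm]
        exact Finset.sum_congr rfl fun s _ => Finset.sum_congr rfl fun t _ => by
          rw [hθ a b, hμs a b])]
    have hS : (∑ a, ∑ b, if (F.deleteEdges {s(v, u)}).Adj a b then
          θe a b (Function.update y v t a) (Function.update y v t b) else 0) =
        ∑ a, ∑ b, if (F.deleteEdges {s(v, u)}).Adj a b then θe a b (y a) (y b) else 0 := by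
      refine Finset.sum_congr rfl fun a _ => Finset.sum_congr rfl fun b _ => ?_
      split_ifs with h
      · rw [Function.update_of_ne (hiso _ _ h).1, Function.update_of_ne (hiso _ _ h).2]
      · rfl
    have hU : (∑ w, θv w (Function.update y v t w)) =
        (∑ w, θv w (y w)) - θv v (y v) + θv v t := by
      have : ∀ w, θv w (Function.update y v t w) =
          θv w (y w) + if w = v then θv v t - θv v (y v) else 0 := by
        intro w
        by_cases h : w = v
        · subst h; simp
        · simp [h]
      simp only [this, Finset.sum_add_distrib, Finset.sum_ite_eq', Finset.mem_univ, if_true]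
      ring
    simp only [Finset.sum_add_distrib, Finset.sum_sub_distrib, Finset.sum_ite_eq',
      Finset.mem_univ, if_true, add_mul, sub_mul, ite_mul, zero_mul] at hy
    have hA : (∑ w, ∑ s, if w = u then m w s * μv w s else 0) = ∑ s, m u s * μv u s := by
      rw [Finset.sum_eq_single u (by intro a _ ha; simp [ha]) (by simp)]
      simp
    have hB : (∑ w, ∑ s, if w = v then θv w s * μv w s else 0) = ∑ s, θv v s * μv v s := by
      rw [Finset.sum_eq_single v (by intro a _ ha; simp [ha]) (by simp)]
      simp
    rw [hA, hB] at hy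
    have hM : ∑ s, m u s * μv u s ≤
        ∑ s, θv v s * μv v s + ∑ s, ∑ t, θe u v s t * μe u v s t := by
      have e1 : ∑ s, θv v s * μv v s = ∑ s, ∑ t, θv v t * μe u v s t := by
        rw [Finset.sum_comm]
        refine Finset.sum_congr rfl fun t _ => ?_
        rw [← Finset.mul_sum, ← hm v u hvu t]
        exact congrArg _ (Finset.sum_congr rfl fun s _ => hμs _ _ _ _)
      rw [e1, ← Finset.sum_add_distrib]
      refine Finset.sum_le_sum fun s _ => ?_
      rw [← hm u v hvu.symm s, Finset.mul_sum, ← Finset.sum_add_distrib]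
      refine Finset.sum_le_sum fun t _ => ?_
      rw [← add_mul]
      exact mul_le_mul_of_nonneg_right (fmin_le (fun t => θv v t + θe u v s t) t)
        (h0 u v hvu.symm s t)
    rw [hS, hU]
    simp only [Function.update_self, Function.update_of_ne huv]
    have ht' : θv v t + θe u v (y u) t = m u (y u) := ht
    linarith
  · push Not at hE
    choose y hy using fun u => exists_eq_fmin (θv u)
    refine ⟨y, ?_⟩
    simp only [ip, hE, if_false, Finset.sum_const_zero, zero_div, add_zero]
    refine Finset.sum_le_sum fun u _ => ?_
    rw [hy]
    exact fmin_le_sum_mul _ _ (hμv u) (hμ1 u)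

/-- Weak duality between acyclic decompositions and the local polytope. -/
lemma Udec_le_ip (G : SimpleGraph V) [DecidableRel G.Adj]
    (Y : V → Type) [∀ u, Fintype (Y u)] [∀ u, Nonempty (Y u)]
    (θv : ∀ u, Y u → ℝ) (θe : ∀ u v, Y u → Y v → ℝ)
    (T : Type) [Fintype T] (H : T → G.Subgraph)
    [∀ τ, DecidablePred (· ∈ (H τ).verts)] [∀ τ, DecidableRel (H τ).Adj]
    (hacyc : ∀ τ, (H τ).spanningCoe.IsAcyclic)
    (θτv : ∀ τ : T, ∀ u, Y u → ℝ) (θτe : ∀ τ : T, ∀ u v, Y u → Y v → ℝ)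
    (hsym : ∀ τ u v s t, θτe τ u v s t = θτe τ v u t s)
    (hv : ∀ (u : V) (s : Y u), (∑ τ, if u ∈ (H τ).verts then θτv τ u s else 0) = θv u s)
    (he : ∀ u v : V, G.Adj u v → ∀ (s : Y u) (t : Y v),
      (∑ τ, if (H τ).Adj u v then θτe τ u v s t else 0) = θe u v s t)
    (μv : ∀ u, Y u → ℝ) (μe : ∀ u v, Y u → Y v → ℝ) (hμ : memLocal G Y μv μe) :
    Udec G Y T H θτv θτe ≤ ip G Y θv θe μv μe := by
  obtain ⟨h0, h0e, hs, -, h1, -, hm⟩ := hμ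
  have hτ : ∀ τ, fmin (fun y : ∀ u, Y u =>
      (∑ u, if u ∈ (H τ).verts then θτv τ u (y u) else 0) +
        (∑ u, ∑ v, if (H τ).Adj u v then θτe τ u v (y u) (y v) else 0) / 2) ≤
      (∑ u, ∑ s, (if u ∈ (H τ).verts then θτv τ u s else 0) * μv u s) +
        (∑ u, ∑ v, if (H τ).Adj u v then ∑ s, ∑ t, θτe τ u v s t * μe u v s t else 0) / 2 := by
    intro τ
    let : DecidableRel (H τ).spanningCoe.Adj := inferInstanceAs (DecidableRel (H τ).Adj)
    obtain ⟨y, hy⟩ := exists_energy_le_ip Y (θτe τ) (hsym τ) μv μe h0 h1 hs (H τ).spanningCoe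
      (hacyc τ) (fun u v h => h0e u v ((H τ).adj_sub h)) (fun u v h => hm u v ((H τ).adj_sub h))
      (fun u s => if u ∈ (H τ).verts then θτv τ u s else 0)
    exact (fmin_le _ y).trans hy
  refine (Finset.sum_le_sum fun τ _ => hτ τ).trans_eq ?_
  rw [Finset.sum_add_distrib, ← Finset.sum_div]
  unfold ip
  refine congrArg₂ (· + ·) ?_ (congrArg (· / 2) ?_)
  · rw [Finset.sum_comm]
    refine Finset.sum_congr rfl fun u _ => ?_
    rw [Finset.sum_comm]
    exact Finset.sum_congr rfl fun s _ => by rw [← Finset.sum_mul, hv]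
  · rw [Finset.sum_comm]
    refine Finset.sum_congr rfl fun u _ => ?_
    rw [Finset.sum_comm]
    refine Finset.sum_congr rfl fun v _ => ?_
    split_ifs with h
    · have : ∀ τ, (if (H τ).Adj u v then ∑ s, ∑ t, θτe τ u v s t * μe u v s t else 0) =
          ∑ s, ∑ t, (if (H τ).Adj u v then θτe τ u v s t else 0) * μe u v s t := by
        intro τ; split_ifs <;> simp
      simp only [this]
      rw [Finset.sum_comm]
      refine Finset.sum_congr rfl fun s _ => ?_
      rw [Finset.sum_comm]
      exact Finset.sum_congr rfl fun t _ => by rw [← Finset.sum_mul, he u v h]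
    · exact Finset.sum_eq_zero fun τ _ => if_neg fun hadj => h ((H τ).adj_sub hadj)

/-- Any reparametrization yields a feasible decomposition with at least the same dual value. -/
lemma exists_dualD_le_Udec (G : SimpleGraph V) [DecidableRel G.Adj]
    (Y : V → Type) [∀ u, Fintype (Y u)] [∀ u, Nonempty (Y u)]
    (θv : ∀ u, Y u → ℝ) (θe : ∀ u v, Y u → Y v → ℝ)
    (hθsym : ∀ u v s t, θe u v s t = θe v u t s)
    (T : Type) [Fintype T] (H : T → G.Subgraph)
    [∀ τ, DecidablePred (· ∈ (H τ).verts)] [∀ τ, DecidableRel (H τ).Adj]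
    (hcovV : ∀ u : V, ∃ τ, u ∈ (H τ).verts)
    (hcovE : ∀ u v : V, G.Adj u v → ∃ τ, (H τ).Adj u v)
    (φ : ∀ (u v : V), Y u → ℝ) :
    ∃ (θτv : ∀ τ : T, ∀ u, Y u → ℝ) (θτe : ∀ τ : T, ∀ u v, Y u → Y v → ℝ),
      (∀ τ u v s t, θτe τ u v s t = θτe τ v u t s) ∧
      (∀ (u : V) (s : Y u), (∑ τ, if u ∈ (H τ).verts then θτv τ u s else 0) = θv u s) ∧
      (∀ u v : V, G.Adj u v → ∀ (s : Y u) (t : Y v),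
        (∑ τ, if (H τ).Adj u v then θτe τ u v s t else 0) = θe u v s t) ∧
      dualD G Y θv θe φ ≤ Udec G Y T H θτv θτe := by
  let n : V → ℝ := fun u => ∑ τ, if u ∈ (H τ).verts then 1 else 0
  let e : V → V → ℝ := fun u v => ∑ τ, if (H τ).Adj u v then 1 else 0
  have hn : ∀ u, 0 < n u := fun u => by
    obtain ⟨τ, hτ⟩ := hcovV u
    exact Finset.sum_pos' (fun τ _ => by split_ifs <;> simp) ⟨τ, Finset.mem_univ _, by simp [hτ]⟩
  have he : ∀ u v, G.Adj u v → 0 < e u v := fun u v h => by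
    obtain ⟨τ, hτ⟩ := hcovE u v h
    exact Finset.sum_pos' (fun τ _ => by split_ifs <;> simp) ⟨τ, Finset.mem_univ _, by simp [hτ]⟩
  have he0 : ∀ u v, 0 ≤ e u v := fun u v =>
    Finset.sum_nonneg fun τ _ => by split_ifs <;> simp
  have hes : ∀ u v, e u v = e v u := fun u v =>
    Finset.sum_congr rfl fun τ _ => by simp only [(H τ).adj_comm u v]
  have hsumn : ∀ u x, (∑ τ, if u ∈ (H τ).verts then x / n u else 0) = x := fun u x => by
    have : ∀ τ, (if u ∈ (H τ).verts then x / n u else 0) =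
        x / n u * if u ∈ (H τ).verts then 1 else 0 := fun τ => by split_ifs <;> simp
    simp only [this, ← Finset.mul_sum]
    exact div_mul_cancel₀ x (hn u).ne'
  have hsume : ∀ u v x, G.Adj u v → (∑ τ, if (H τ).Adj u v then x / e u v else 0) = x :=
    fun u v x h => by
    have : ∀ τ, (if (H τ).Adj u v then x / e u v else 0) =
        x / e u v * if (H τ).Adj u v then 1 else 0 := fun τ => by split_ifs <;> simp
    simp only [this, ← Finset.mul_sum]
    exact div_mul_cancel₀ x (he u v h).ne'
  have hnadj : ∀ u v, ¬ G.Adj u v → ∀ τ, ¬ (H τ).Adj u v := fun u v h τ h' =>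
    h ((H τ).adj_sub h')
  refine ⟨fun τ u s => repUnary G Y θv φ u s / n u +
      ∑ v, if (H τ).Adj u v then φ u v s / e u v else 0,
    fun τ u v s t => θe u v s t / e u v, ?_, ?_, ?_, ?_⟩
  · intro τ u v s t
    change θe u v s t / e u v = θe v u t s / e v u
    rw [hθsym, hes]
  · intro u s
    have : ∀ τ, (if u ∈ (H τ).verts then repUnary G Y θv φ u s / n u +
          ∑ v, (if (H τ).Adj u v then φ u v s / e u v else 0) else 0) =
        (if u ∈ (H τ).verts then repUnary G Y θv φ u s / n u else 0) +
          ∑ v, if (H τ).Adj u v then φ u v s / e u v else 0 := by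
      intro τ
      split_ifs with h
      · rfl
      · rw [Finset.sum_eq_zero, add_zero]
        exact fun v _ => if_neg fun h' => h ((H τ).edge_vert h')
    simp only [this, Finset.sum_add_distrib]
    rw [hsumn, Finset.sum_comm, repUnary, sub_add_eq_add_sub, sub_eq_iff_eq_add, add_right_inj]
    refine Finset.sum_congr rfl fun v _ => ?_
    split_ifs with h
    · exact hsume u v _ h
    · exact Finset.sum_eq_zero fun τ _ => if_neg (hnadj u v h τ)
  · exact fun u v h s t => hsume u v _ h
  · have hD : dualD G Y θv θe φ = ∑ τ, ((∑ u, if u ∈ (H τ).verts then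
          (fmin fun s : Y u => repUnary G Y θv φ u s) / n u else 0) +
        (∑ u, ∑ v, if (H τ).Adj u v then
          (fmin fun p : Y u × Y v => repPair Y θe φ u v p.1 p.2) / e u v else 0) / 2) := by
      rw [Finset.sum_add_distrib, ← Finset.sum_div]
      unfold dualD
      refine congrArg₂ (· + ·) ?_ (congrArg (· / 2) ?_)
      · rw [Finset.sum_comm]
        exact Finset.sum_congr rfl fun u _ => (hsumn u _).symm
      · symm
        rw [Finset.sum_comm]
        refine Finset.sum_congr rfl fun u _ => ?_
        rw [Finset.sum_comm]
        refine Finset.sum_congr rfl fun v _ => ?_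
        split_ifs with h
        · exact hsume u v _ h
        · exact Finset.sum_eq_zero fun τ _ => if_neg (hnadj u v h τ)
    rw [hD]
    refine Finset.sum_le_sum fun τ _ => Finset.le_inf' _ _ fun y _ => ?_
    have hcomm : (∑ u, ∑ v, if (H τ).Adj u v then φ v u (y v) / e u v else 0) =
        ∑ u, ∑ v, if (H τ).Adj u v then φ u v (y u) / e u v else 0 := by
      rw [Finset.sum_comm]
      refine Finset.sum_congr rfl fun u _ => Finset.sum_congr rfl fun v _ => ?_
      simp only [(H τ).adj_comm v u, hes v u]
    have hE : (∑ u, if u ∈ (H τ).verts then repUnary G Y θv φ u (y u) / n u +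
          ∑ v, (if (H τ).Adj u v then φ u v (y u) / e u v else 0) else 0) +
        (∑ u, ∑ v, if (H τ).Adj u v then θe u v (y u) (y v) / e u v else 0) / 2 =
        (∑ u, if u ∈ (H τ).verts then repUnary G Y θv φ u (y u) / n u else 0) +
        (∑ u, ∑ v, if (H τ).Adj u v then
          repPair Y θe φ u v (y u) (y v) / e u v else 0) / 2 := by
      have h1 : ∀ u, (if u ∈ (H τ).verts then repUnary G Y θv φ u (y u) / n u +
            ∑ v, (if (H τ).Adj u v then φ u v (y u) / e u v else 0) else 0) =
          (if u ∈ (H τ).verts then repUnary G Y θv φ u (y u) / n u else 0) +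
            ∑ v, if (H τ).Adj u v then φ u v (y u) / e u v else 0 := by
        intro u
        split_ifs with h
        · rfl
        · rw [Finset.sum_eq_zero, add_zero]
          exact fun v _ => if_neg fun h' => h ((H τ).edge_vert h')
      have h2 : ∀ u v, (if (H τ).Adj u v then
            repPair Y θe φ u v (y u) (y v) / e u v else 0) =
          (if (H τ).Adj u v then θe u v (y u) (y v) / e u v else 0) +
          (if (H τ).Adj u v then φ u v (y u) / e u v else 0) +
          (if (H τ).Adj u v then φ v u (y v) / e u v else 0) := by
        intro u v
        split_ifs
        · rw [repPair]; ring
        · simp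
      simp only [h1, h2, Finset.sum_add_distrib]
      rw [hcomm]
      ring
    rw [hE]
    gcongr with u _ u _ v _
    · split_ifs
      · have := hn u
        gcongr
        exact fmin_le (fun s => repUnary G Y θv φ u s) (y u)
      · rfl
    · split_ifs
      · have := he0 u v
        gcongr
        exact fmin_le (fun p : Y u × Y v => repPair Y θe φ u v p.1 p.2) (y u, y v)
      · rfl

/-- The polytope obtained from the local polytope by dropping the marginalization constraints. -/
def relaxedPolytope (G : SimpleGraph V) (Y : V → Type) [∀ u, Fintype (Y u)] :
    Set ((∀ u, Y u → ℝ) × (∀ u v, Y u → Y v → ℝ)) :=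
  {μ | (∀ u s, 0 ≤ μ.1 u s) ∧ (∀ u v s t, 0 ≤ μ.2 u v s t) ∧
    (∀ u v s t, μ.2 u v s t = μ.2 v u t s) ∧
    (∀ u v, ¬ G.Adj u v → ∀ s t, μ.2 u v s t = 0) ∧
    (∀ u, ∑ s, μ.1 u s = 1) ∧ (∀ u v, G.Adj u v → ∑ s, ∑ t, μ.2 u v s t = 1)}

/-- The marginalization defect of `μ` together with its objective value. -/
noncomputable def defectIp (G : SimpleGraph V) [DecidableRel G.Adj]
    (Y : V → Type) [∀ u, Fintype (Y u)]
    (θv : ∀ u, Y u → ℝ) (θe : ∀ u v, Y u → Y v → ℝ) :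
    ((∀ u, Y u → ℝ) × (∀ u v, Y u → Y v → ℝ)) →ₗ[ℝ] (∀ u, V → Y u → ℝ) × ℝ where
  toFun μ := (fun u v s => if G.Adj u v then ∑ t, μ.2 u v s t - μ.1 u s else 0,
    ip G Y θv θe μ.1 μ.2)
  map_add' μ ν := by
    refine Prod.ext ?_ ?_
    · funext u v s
      simp only [Prod.fst_add, Prod.snd_add, Pi.add_apply, Finset.sum_add_distrib]
      split_ifs <;> ring
    · simp only [ip, Prod.fst_add, Prod.snd_add, Pi.add_apply, Finset.sum_add_distrib, mul_add,
        ite_add_zero]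
      ring
  map_smul' c μ := by
    refine Prod.ext ?_ ?_
    · funext u v s
      simp only [Prod.smul_fst, Prod.smul_snd, Pi.smul_apply, smul_eq_mul, ← Finset.mul_sum,
        RingHom.id_apply]
      split_ifs <;> ring
    · simp only [ip, Prod.smul_fst, Prod.smul_snd, Pi.smul_apply, smul_eq_mul,
        RingHom.id_apply, mul_left_comm _ c, ← Finset.mul_sum, ← mul_ite_zero]
      ring

omit [DecidableEq V] in
lemma memLocal_iff (G : SimpleGraph V) [DecidableRel G.Adj] (Y : V → Type) [∀ u, Fintype (Y u)]
    (θv : ∀ u, Y u → ℝ) (θe : ∀ u v, Y u → Y v → ℝ)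
    (μ : (∀ u, Y u → ℝ) × (∀ u v, Y u → Y v → ℝ)) :
    memLocal G Y μ.1 μ.2 ↔ μ ∈ relaxedPolytope G Y ∧ (defectIp G Y θv θe μ).1 = 0 := by
  constructor
  · rintro ⟨h0, h0e, hs, hz, h1, -, hm⟩
    refine ⟨⟨h0, fun u v s t => ?_, hs, hz, h1, fun u v h => ?_⟩, ?_⟩
    · by_cases h : G.Adj u v
      · exact h0e u v h s t
      · exact (hz u v h s t).ge
    · rw [← h1 u]
      exact Finset.sum_congr rfl fun s _ => hm u v h s
    · funext u v s
      change (if G.Adj u v then ∑ t, μ.2 u v s t - μ.1 u s else 0) = 0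
      split_ifs with h
      · rw [hm u v h, sub_self]
      · rfl
  · rintro ⟨⟨h0, h0e, hs, hz, h1, -⟩, hd⟩
    have hm : ∀ u v, G.Adj u v → ∀ s : Y u, ∑ t, μ.2 u v s t = μ.1 u s := by
      intro u v h s
      have h' : (if G.Adj u v then ∑ t, μ.2 u v s t - μ.1 u s else 0) = 0 :=
        congrFun (congrFun (congrFun hd u) v) s
      rw [if_pos h] at h'
      exact sub_eq_zero.1 h'
    refine ⟨h0, fun u v _ => h0e u v, hs, hz, h1, fun u v h t => ?_, hm⟩
    rw [← hm v u h.symm t]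
    exact Finset.sum_congr rfl fun s _ => hs _ _ _ _

omit [Fintype V] [DecidableEq V] in
lemma convex_relaxedPolytope (G : SimpleGraph V) (Y : V → Type) [∀ u, Fintype (Y u)] :
    Convex ℝ (relaxedPolytope G Y) := by
  rintro μ ⟨a1, a2, a3, a4, a5, a6⟩ ν ⟨b1, b2, b3, b4, b5, b6⟩ a b ha hb hab
  refine ⟨fun u s => ?_, fun u v s t => ?_, fun u v s t => ?_, fun u v h s t => ?_, fun u => ?_,
    fun u v h => ?_⟩ <;>
  simp only [Prod.fst_add, Prod.snd_add, Prod.smul_fst, Prod.smul_snd, Pi.add_apply,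
    Pi.smul_apply, smul_eq_mul, Finset.sum_add_distrib, ← Finset.mul_sum]
  · have := a1 u s
    have := b1 u s
    positivity
  · have := a2 u v s t
    have := b2 u v s t
    positivity
  · rw [a3, b3]
  · rw [a4 u v h, b4 u v h]
    simp
  · rw [a5, b5]
    simpa using hab
  · rw [a6 u v h, b6 u v h]
    simpa using hab

omit [Fintype V] [DecidableEq V] in
lemma isCompact_relaxedPolytope (G : SimpleGraph V) (Y : V → Type) [∀ u, Fintype (Y u)] :
    IsCompact (relaxedPolytope G Y) := by
  refine IsCompact.of_isClosed_subset
    (isCompact_Icc (a := (0 : (∀ u, Y u → ℝ) × (∀ u v, Y u → Y v → ℝ))) (b := 1)) ?_ ?_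
  · simp only [relaxedPolytope, Set.ofPred_and, Set.ofPred_forall]
    refine IsClosed.inter ?_ (IsClosed.inter ?_ (IsClosed.inter ?_ (IsClosed.inter ?_
      (IsClosed.inter ?_ ?_))))
    · exact isClosed_iInter fun u => isClosed_iInter fun s =>
        isClosed_le (by fun_prop) (by fun_prop)
    · exact isClosed_iInter fun u => isClosed_iInter fun v => isClosed_iInter fun s =>
        isClosed_iInter fun t => isClosed_le (by fun_prop) (by fun_prop)
    · exact isClosed_iInter fun u => isClosed_iInter fun v => isClosed_iInter fun s =>
        isClosed_iInter fun t => isClosed_eq (by fun_prop) (by fun_prop)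
    · exact isClosed_iInter fun u => isClosed_iInter fun v => isClosed_iInter fun _ =>
        isClosed_iInter fun s => isClosed_iInter fun t => isClosed_eq (by fun_prop) (by fun_prop)
    · exact isClosed_iInter fun u => isClosed_eq (by fun_prop) (by fun_prop)
    · exact isClosed_iInter fun u => isClosed_iInter fun v => isClosed_iInter fun _ =>
        isClosed_eq (by fun_prop) (by fun_prop)
  · rintro μ ⟨a1, a2, a3, a4, a5, a6⟩
    refine ⟨⟨a1, a2⟩, ⟨fun u s => ?_, fun u v s t => ?_⟩⟩
    · change μ.1 u s ≤ 1
      rw [← a5 u]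
      exact Finset.single_le_sum (fun s _ => a1 u s) (Finset.mem_univ s)
    · change μ.2 u v s t ≤ 1
      by_cases h : G.Adj u v
      · rw [← a6 u v h]
        exact (Finset.single_le_sum (fun t _ => a2 u v s t) (Finset.mem_univ t)).trans
          (Finset.single_le_sum (f := fun s => ∑ t, μ.2 u v s t)
            (fun s _ => Finset.sum_nonneg fun t _ => a2 u v s t) (Finset.mem_univ s))
      · rw [a4 u v h]
        exact zero_le_one

omit [DecidableEq V] in
/-- The Lagrangian of the local polytope relaxation is the objective for reparametrized costs. -/
lemma ip_rep (G : SimpleGraph V) [DecidableRel G.Adj] (Y : V → Type) [∀ u, Fintype (Y u)]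
    (θv : ∀ u, Y u → ℝ) (θe : ∀ u v, Y u → Y v → ℝ) (φ : ∀ u, V → Y u → ℝ)
    (μv : ∀ u, Y u → ℝ) (μe : ∀ u v, Y u → Y v → ℝ)
    (hs : ∀ u v s t, μe u v s t = μe v u t s) :
    ip G Y (repUnary G Y θv φ) (repPair Y θe φ) μv μe = ip G Y θv θe μv μe +
      ∑ u, ∑ v, ∑ s, φ u v s * if G.Adj u v then ∑ t, μe u v s t - μv u s else 0 := by
  have h1 : (∑ u, ∑ s, repUnary G Y θv φ u s * μv u s) =
      (∑ u, ∑ s, θv u s * μv u s) -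
        ∑ u, ∑ v, if G.Adj u v then ∑ s, φ u v s * μv u s else 0 := by
    rw [← Finset.sum_sub_distrib]
    refine Finset.sum_congr rfl fun u _ => ?_
    simp only [repUnary, sub_mul, Finset.sum_sub_distrib, Finset.sum_mul]
    rw [Finset.sum_comm]
    congr 1
    refine Finset.sum_congr rfl fun v _ => ?_
    split_ifs <;> simp
  have h2 : (∑ u, ∑ v, if G.Adj u v then ∑ s, ∑ t, repPair Y θe φ u v s t * μe u v s t else 0) =
      (∑ u, ∑ v, if G.Adj u v then ∑ s, ∑ t, θe u v s t * μe u v s t else 0) +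
      (∑ u, ∑ v, if G.Adj u v then ∑ s, ∑ t, φ u v s * μe u v s t else 0) +
      (∑ u, ∑ v, if G.Adj u v then ∑ s, ∑ t, φ v u t * μe u v s t else 0) := by
    simp only [← Finset.sum_add_distrib]
    refine Finset.sum_congr rfl fun u _ => Finset.sum_congr rfl fun v _ => ?_
    split_ifs
    · simp only [← Finset.sum_add_distrib, repPair, add_mul]
    · simp
  have h3 : (∑ u, ∑ v, if G.Adj u v then ∑ s, ∑ t, φ v u t * μe u v s t else 0) =
      ∑ u, ∑ v, if G.Adj u v then ∑ s, ∑ t, φ u v s * μe u v s t else 0 := by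
    rw [Finset.sum_comm]
    refine Finset.sum_congr rfl fun u _ => Finset.sum_congr rfl fun v _ => ?_
    simp only [G.adj_comm v u]
    rw [Finset.sum_comm]
    simp only [hs v u]
  have h4 : (∑ u, ∑ v, ∑ s, φ u v s * if G.Adj u v then ∑ t, μe u v s t - μv u s else 0) =
      (∑ u, ∑ v, if G.Adj u v then ∑ s, ∑ t, φ u v s * μe u v s t else 0) -
        ∑ u, ∑ v, if G.Adj u v then ∑ s, φ u v s * μv u s else 0 := by
    simp only [← Finset.sum_sub_distrib]
    refine Finset.sum_congr rfl fun u _ => Finset.sum_congr rfl fun v _ => ?_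
    split_ifs
    · simp only [← Finset.sum_sub_distrib, ← Finset.mul_sum, mul_sub]
    · simp
  unfold ip
  rw [h1, h2, h3, h4]
  ring

omit [DecidableEq V] in
/-- The dual value is attained by the Lagrangian at a point of the relaxed polytope. -/
lemma exists_ip_rep_eq_dualD (G : SimpleGraph V) [DecidableRel G.Adj]
    (Y : V → Type) [∀ u, Fintype (Y u)] [∀ u, Nonempty (Y u)]
    (θv : ∀ u, Y u → ℝ) (θe : ∀ u v, Y u → Y v → ℝ)
    (hθsym : ∀ u v s t, θe u v s t = θe v u t s) (φ : ∀ u, V → Y u → ℝ) :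
    ∃ μ ∈ relaxedPolytope G Y,
      ip G Y (repUnary G Y θv φ) (repPair Y θe φ) μ.1 μ.2 = dualD G Y θv θe φ := by
  classical
  choose s hs using fun u => exists_eq_fmin (fun s : Y u => repUnary G Y θv φ u s)
  choose q hq using fun u v => exists_eq_fmin
    (fun p : Y u × Y v => repPair Y θe φ u v p.1 p.2)
  have hrs : ∀ u v a b, repPair Y θe φ u v a b = repPair Y θe φ v u b a := by
    intro u v a b
    rw [repPair, repPair, hθsym]
    ring
  have hle : ∀ u v, repPair Y θe φ u v (q u v).1 (q u v).2 ≤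
      repPair Y θe φ v u (q v u).1 (q v u).2 := by
    intro u v
    rw [hq u v, hrs v u]
    exact fmin_le (fun p : Y u × Y v => repPair Y θe φ u v p.1 p.2) ((q v u).2, (q v u).1)
  have hsingle : ∀ u v (f : Y u → Y v → ℝ) (c : Y u) (d : Y v),
      ∑ a, ∑ b, f a b * (if a = c then if b = d then 1 else 0 else 0) = f c d := by
    intro u v f c d
    rw [Finset.sum_eq_single c (by intro a _ ha; simp [ha]) (by simp)]
    simp
  have hpair : ∀ u v, G.Adj u v → ∀ f : Y u → Y v → ℝ,
      ∑ a, ∑ b, f a b * (if G.Adj u v then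
        ((if a = (q u v).1 then if b = (q u v).2 then 1 else 0 else 0) +
          (if a = (q v u).2 then if b = (q v u).1 then 1 else 0 else 0)) / 2 else 0) =
      (f (q u v).1 (q u v).2 + f (q v u).2 (q v u).1) / 2 := by
    intro u v h f
    simp only [if_pos h, mul_div_assoc', ← Finset.sum_div, mul_add, Finset.sum_add_distrib,
      hsingle]
  refine ⟨(fun u a => if a = s u then 1 else 0, fun u v a b => if G.Adj u v then
    ((if a = (q u v).1 then if b = (q u v).2 then 1 else 0 else 0) +
      (if a = (q v u).2 then if b = (q v u).1 then 1 else 0 else 0)) / 2 else 0),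
    ⟨?_, ?_, ?_, ?_, ?_, ?_⟩, ?_⟩
  · intro u a
    dsimp only
    split_ifs <;> simp
  · intro u v a b
    dsimp only
    positivity
  · intro u v a b
    simp only [G.adj_comm u v]
    split_ifs <;> simp_all
  · intro u v h a b
    exact if_neg h
  · intro u
    simp
  · intro u v h
    have := hpair u v h fun _ _ => 1
    simp only [one_mul] at this
    rw [this]
    norm_num
  · unfold ip dualD
    refine congrArg₂ (· + ·) ?_ (congrArg (· / 2) ?_)
    · refine Finset.sum_congr rfl fun u _ => ?_
      simp [← hs u]
    · refine Finset.sum_congr rfl fun u _ => Finset.sum_congr rfl fun v _ => ?_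
      split_ifs with h
      · refine (hpair u v h (repPair Y θe φ u v)).trans ?_
        rw [← hq u v, hrs u v (q v u).2, le_antisymm (hle v u) (hle u v)]
        ring
      · rfl

omit [Fintype V] [DecidableEq V] in
lemma memLocal_nonempty (G : SimpleGraph V) [DecidableRel G.Adj]
    (Y : V → Type) [∀ u, Fintype (Y u)] [∀ u, Nonempty (Y u)] :
    ∃ μ : (∀ u, Y u → ℝ) × (∀ u v, Y u → Y v → ℝ), memLocal G Y μ.1 μ.2 := by
  classical
  let s : ∀ u, Y u := fun u => Classical.arbitrary _
  refine ⟨(fun u a => if a = s u then 1 else 0, fun u v a b => if G.Adj u v then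
    (if a = s u then 1 else 0) * (if b = s v then 1 else 0) else 0), ?_, ?_, ?_, ?_, ?_, ?_, ?_⟩
  · intro u a
    dsimp only
    positivity
  · intro u v _ a b
    dsimp only
    positivity
  · intro u v a b
    simp only [G.adj_comm u v, mul_comm]
  · intro u v h a b
    exact if_neg h
  · simp
  · intro u v h t
    simp [h]
  · intro u v h t
    simp [h]

/-- Strong duality between the local polytope relaxation and the Lagrange dual. -/
lemma exists_isLeast_ip_lt_dualD (G : SimpleGraph V) [DecidableRel G.Adj]
    (Y : V → Type) [∀ u, Fintype (Y u)] [∀ u, Nonempty (Y u)]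
    (θv : ∀ u, Y u → ℝ) (θe : ∀ u v, Y u → Y v → ℝ)
    (hθsym : ∀ u v s t, θe u v s t = θe v u t s) :
    ∃ p : ℝ, IsLeast {r : ℝ | ∃ μv μe, memLocal G Y μv μe ∧ r = ip G Y θv θe μv μe} p ∧
      ∀ c < p, ∃ φ, c < dualD G Y θv θe φ := by
  classical
  let ψ := defectIp G Y θv θe
  have hψ : Continuous ψ := ψ.continuous_of_finiteDimensional
  have hK := isCompact_relaxedPolytope G Y
  obtain ⟨μ₀, hμ₀⟩ := memLocal_nonempty G Y
  obtain ⟨μ, ⟨hμ, hμd⟩, hmin⟩ :=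
    (hK.inter_right (isClosed_eq (f := fun μ => (ψ μ).1) (g := fun _ => 0) (by fun_prop)
      (by fun_prop))).exists_isMinOn ⟨μ₀, (memLocal_iff G Y θv θe μ₀).1 hμ₀⟩
      (f := fun μ => (ψ μ).2) (by fun_prop)
  have hmin' : ∀ ν ∈ relaxedPolytope G Y, (ψ ν).1 = 0 → (ψ μ).2 ≤ (ψ ν).2 :=
    fun ν h h' => hmin ⟨h, h'⟩
  refine ⟨(ψ μ).2, ⟨⟨μ.1, μ.2, (memLocal_iff G Y θv θe μ).2 ⟨hμ, hμd⟩, rfl⟩, ?_⟩, ?_⟩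
  · rintro r ⟨νv, νe, hν, rfl⟩
    obtain ⟨h, h'⟩ := (memLocal_iff G Y θv θe (νv, νe)).1 hν
    exact hmin' _ h h'
  intro c hc
  have hnot : ((0, c) : (∀ u, V → Y u → ℝ) × ℝ) ∉ ψ '' relaxedPolytope G Y := by
    rintro ⟨ν, hν, h⟩
    have := hmin' ν hν (by rw [h])
    rw [h] at this
    exact hc.not_ge this
  obtain ⟨f, w, hfw, hf⟩ := geometric_hahn_banach_point_closed
    ((convex_relaxedPolytope G Y).linear_image ψ) (hK.image hψ).isClosed hnot
  have hdec : ∀ (x : ∀ u, V → Y u → ℝ) (r : ℝ), f (x, r) = f (x, 0) + r * f (0, 1) := by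
    intro x r
    rw [← smul_eq_mul, ← map_smul, ← map_add]
    simp
  have hlin : ∀ x : ∀ u, V → Y u → ℝ, f (x, 0) =
      ∑ u, ∑ v, ∑ s, f (Pi.single u (Pi.single v (Pi.single s 1)), 0) * x u v s := by
    intro x
    have hx : ((x, 0) : (∀ u, V → Y u → ℝ) × ℝ) = ∑ u, ∑ v, ∑ s,
        x u v s • ((Pi.single u (Pi.single v (Pi.single s 1)), 0) :
          (∀ u, V → Y u → ℝ) × ℝ) := by
      refine Prod.ext ?_ ?_
      · funext a b i
        simp only [Prod.fst_sum, Finset.sum_apply, Prod.smul_fst, Pi.smul_apply, smul_eq_mul]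
        rw [Finset.sum_eq_single a (by intro u _ h; simp [Pi.single_eq_of_ne h.symm]) (by simp),
          Finset.sum_eq_single b (by intro u _ h; simp [Pi.single_eq_of_ne h.symm]) (by simp),
          Finset.sum_eq_single i (by intro u _ h; simp [Pi.single_eq_of_ne h.symm]) (by simp)]
        simp
      · simp [Prod.snd_sum]
    conv_lhs => rw [hx]
    simp only [map_sum, map_smul, smul_eq_mul, mul_comm]
  have hk : 0 < f (0, 1) := by
    have h1 := hf _ ⟨μ, hμ, rfl⟩
    have h2 : ψ μ = (0, (ψ μ).2) := Prod.ext hμd rfl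
    rw [h2, hdec] at h1
    rw [hdec] at hfw
    nlinarith
  refine ⟨fun u v s => f (Pi.single u (Pi.single v (Pi.single s 1)), 0) / f (0, 1), ?_⟩
  obtain ⟨ν, hν, hνD⟩ := exists_ip_rep_eq_dualD G Y θv θe hθsym
    fun u v s => f (Pi.single u (Pi.single v (Pi.single s 1)), 0) / f (0, 1)
  rw [← hνD, ip_rep G Y θv θe _ _ _ hν.2.2.1]
  have h1 := hfw.trans (hf _ ⟨ν, hν, rfl⟩)
  rw [hdec, ← Prod.mk.eta (p := ψ ν), hdec (ψ ν).1, hlin (ψ ν).1, ← Prod.zero_eq_mk,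
    map_zero, zero_add] at h1
  simp only [div_mul_eq_mul_div, ← Finset.sum_div]
  change c < (ψ ν).2 + (∑ u, ∑ v, ∑ s,
    f (Pi.single u (Pi.single v (Pi.single s 1)), 0) * (ψ ν).1 u v s) / f (0, 1)
  rw [← sub_lt_iff_lt_add', lt_div_iff₀ hk]
  linarith

/-- **For acyclic decompositions, the decomposition-based dual, the Lagrange
dual and the local polytope relaxation all share the same optimal value**:
`sup {U(θ^T) : θ^T ∈ Θ^T} = sup_φ D(φ) = min_{μ∈L} ⟨θ,μ⟩`. -/
theorem statement_9 (G : SimpleGraph V) [DecidableRel G.Adj]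
    (Y : V → Type) [∀ u, Fintype (Y u)] [∀ u, Nonempty (Y u)]
    (θv : ∀ u, Y u → ℝ) (θe : ∀ u v, Y u → Y v → ℝ)
    (hθsym : ∀ u v s t, θe u v s t = θe v u t s)
    (T : Type) [Fintype T]
    (H : T → G.Subgraph)
    [∀ τ, DecidablePred (· ∈ (H τ).verts)] [∀ τ, DecidableRel (H τ).Adj]
    (hcovV : ∀ u : V, ∃ τ, u ∈ (H τ).verts)
    (hcovE : ∀ u v : V, G.Adj u v → ∃ τ, (H τ).Adj u v)
    (hacyc : ∀ τ, (H τ).spanningCoe.IsAcyclic) :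
    ∃ p : ℝ,
      IsLeast {r : ℝ | ∃ μv μe, memLocal G Y μv μe ∧ r = ip G Y θv θe μv μe} p ∧
      IsLUB {r : ℝ | ∃ (θτv : ∀ τ : T, ∀ u, Y u → ℝ) (θτe : ∀ τ : T, ∀ u v, Y u → Y v → ℝ),
          (∀ τ u v s t, θτe τ u v s t = θτe τ v u t s) ∧
          (∀ (u : V) (s : Y u), (∑ τ, if u ∈ (H τ).verts then θτv τ u s else 0) = θv u s) ∧
          (∀ u v : V, G.Adj u v → ∀ (s : Y u) (t : Y v),
              (∑ τ, if (H τ).Adj u v then θτe τ u v s t else 0) = θe u v s t) ∧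
          r = Udec G Y T H θτv θτe} p ∧
      IsLUB (Set.range (dualD G Y θv θe)) p := by
  obtain ⟨p, hp, hD⟩ := exists_isLeast_ip_lt_dualD G Y θv θe hθsym
  obtain ⟨μv, μe, hμ, rfl⟩ := hp.1
  refine ⟨_, hp, ⟨?_, fun b hb => ?_⟩, ⟨?_, fun b hb => ?_⟩⟩
  · rintro r ⟨θτv, θτe, hs, hv, he, rfl⟩
    exact Udec_le_ip G Y θv θe T H hacyc θτv θτe hs hv he μv μe hμ
  · refine le_of_forall_lt fun c hc => ?_
    obtain ⟨φ, hφ⟩ := hD c hc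
    obtain ⟨θτv, θτe, hs, hv, he, h⟩ :=
      exists_dualD_le_Udec G Y θv θe hθsym T H hcovV hcovE φ
    exact (hφ.trans_le h).trans_le (hb ⟨θτv, θτe, hs, hv, he, rfl⟩)
  · rintro r ⟨φ, rfl⟩
    obtain ⟨θτv, θτe, hs, hv, he, h⟩ :=
      exists_dualD_le_Udec G Y θv θe hθsym T H hcovV hcovE φ
    exact h.trans (Udec_le_ip G Y θv θe T H hacyc θτv θτe hs hv he μv μe hμ)
  · refine le_of_forall_lt fun c hc => ?_
    obtain ⟨φ, hφ⟩ := hD c hc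
    exact hφ.trans_le (hb ⟨φ, rfl⟩)
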